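/- For every real p > 2, the function Φ_p fails to be convex, even separately in one argument: there exist a finite dimension d and positive semidefinite d×d complex matrices A_1, A_2, B such that Tr((((A_1 + A_2)/2)^p + B^p)^{1/p}) > (1/2)·Tr((A_1^p + B^p)^{1/p}) + (1/2)·Tr((A_2^p + B^p)^{1/p}). -/

import Mathlib

open Matrix
open scoped ComplexOrder

/-- Matrix power via the functional calculus: for a Hermitian matrix, apply the real
power `x ^ s` to the eigenvalues in its spectral decomposition (so `0 ^ s = 0` for `s > 0`);
junk value `0` for non-Hermitian matrices. -/
noncomputable def matrixRpow {n : Type*} [Fintype n] [DecidableEq n]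
    (A : Matrix n n ℂ) (s : ℝ) : Matrix n n ℂ :=
  if h : A.IsHermitian then
    (h.eigenvectorUnitary : Matrix n n ℂ) *
      Matrix.diagonal (fun i => ((h.eigenvalues i ^ s : ℝ) : ℂ)) *
        (star h.eigenvectorUnitary : Matrix n n ℂ)
  else 0

section MatrixRpow

variable {n : Type*} [Fintype n] [DecidableEq n]

/-- An eigenvector of `A` for `μ` is an eigenvector of `A ^ s` for `μ ^ s`. -/
lemma matrixRpow_mulVec {A : Matrix n n ℂ} (hA : A.IsHermitian) (s : ℝ) {μ : ℝ} {v : n → ℂ}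
    (hv : A *ᵥ v = (μ : ℂ) • v) : matrixRpow A s *ᵥ v = ((μ ^ s : ℝ) : ℂ) • v := by
  have hUU : (star hA.eigenvectorUnitary : Matrix n n ℂ) * (hA.eigenvectorUnitary : Matrix n n ℂ)
      = 1 := Unitary.coe_star_mul_self _
  have hUU' : (hA.eigenvectorUnitary : Matrix n n ℂ) * (star hA.eigenvectorUnitary : Matrix n n ℂ)
      = 1 := Unitary.coe_mul_star_self _
  have hspec : A = (hA.eigenvectorUnitary : Matrix n n ℂ) *
      diagonal (fun i => ((hA.eigenvalues i : ℝ) : ℂ)) *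
        (star hA.eigenvectorUnitary : Matrix n n ℂ) := by
    simpa [Unitary.conjStarAlgAut_apply, Function.comp_def] using hA.spectral_theorem
  rw [matrixRpow, dif_pos hA]
  set U : Matrix n n ℂ := (hA.eigenvectorUnitary : Matrix n n ℂ)
  set V : Matrix n n ℂ := (star hA.eigenvectorUnitary : Matrix n n ℂ)
  have hw : diagonal (fun i => ((hA.eigenvalues i : ℝ) : ℂ)) *ᵥ (V *ᵥ v)
      = (μ : ℂ) • (V *ᵥ v) := by
    rw [← mulVec_smul, ← hv]
    conv_rhs => rw [hspec]
    simp only [mulVec_mulVec]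
    rw [← Matrix.mul_assoc, ← Matrix.mul_assoc, hUU, Matrix.one_mul]
  have hws : diagonal (fun i => ((hA.eigenvalues i ^ s : ℝ) : ℂ)) *ᵥ (V *ᵥ v)
      = ((μ ^ s : ℝ) : ℂ) • (V *ᵥ v) := by
    ext i
    have hi := congrFun hw i
    simp only [mulVec_diagonal, Pi.smul_apply, smul_eq_mul] at hi ⊢
    rcases eq_or_ne ((V *ᵥ v) i) 0 with h0 | h0
    · simp [h0]
    · have : hA.eigenvalues i = μ := by exact_mod_cast mul_right_cancel₀ h0 hi
      rw [this]
  rw [← mulVec_mulVec, ← mulVec_mulVec, hws, mulVec_smul, mulVec_mulVec, hUU', one_mulVec]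

lemma matrixRpow_posSemidef {A : Matrix n n ℂ} (hA : A.PosSemidef) (s : ℝ) :
    (matrixRpow A s).PosSemidef := by
  rw [matrixRpow, dif_pos hA.isHermitian]
  have hD : (diagonal (fun i => ((hA.isHermitian.eigenvalues i ^ s : ℝ) : ℂ))).PosSemidef :=
    PosSemidef.diagonal fun i => by
      simpa using Real.rpow_nonneg (hA.eigenvalues_nonneg i) s
  exact hD.mul_mul_conjTranspose_same _

lemma trace_matrixRpow_re {A : Matrix n n ℂ} (hA : A.IsHermitian) (s : ℝ) :
    (matrixRpow A s).trace.re = ∑ i, hA.eigenvalues i ^ s := by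
  rw [matrixRpow, dif_pos hA, trace_mul_cycle, Unitary.coe_star_mul_self, Matrix.one_mul,
    trace_diagonal, ← Complex.ofReal_sum, Complex.ofReal_re]

lemma matrixRpow_diagonal (w : n → ℝ) (s : ℝ) :
    matrixRpow (diagonal fun i => (w i : ℂ)) s = diagonal fun i => ((w i ^ s : ℝ) : ℂ) := by
  have hH : (diagonal fun i => (w i : ℂ)).IsHermitian :=
    isHermitian_diagonal_of_self_adjoint _ (by ext; simp)
  refine ext_of_mulVec_single fun j => ?_
  rw [matrixRpow_mulVec hH s (μ := w j)]
  · ext i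
    by_cases h : i = j <;> simp [h, mulVec_diagonal]
  · ext i
    by_cases h : i = j <;> simp [h, mulVec_diagonal]

end MatrixRpow

/-- For a positive semidefinite `2 × 2` matrix, the eigenvalues `x ≤ y` satisfy the trace and
determinant relations. -/
lemma exists_trace_matrixRpow_eq {X : Matrix (Fin 2) (Fin 2) ℂ} (hX : X.PosSemidef) (s : ℝ) :
    ∃ x y : ℝ, 0 ≤ x ∧ x ≤ y ∧ x + y = (X 0 0).re + (X 1 1).re ∧
      x * y = (X 0 0).re * (X 1 1).re - Complex.normSq (X 0 1) ∧
      (matrixRpow X s).trace.re = x ^ s + y ^ s := by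
  have hH := hX.isHermitian
  have htr : hH.eigenvalues 0 + hH.eigenvalues 1 = (X 0 0).re + (X 1 1).re := by
    have := congrArg Complex.re hH.trace_eq_sum_eigenvalues
    simpa [trace_fin_two, Fin.sum_univ_two] using this.symm
  have h10 : X 1 0 = star (X 0 1) := (hH.apply 1 0).symm
  have h00 : (X 0 0).im = 0 := Complex.conj_eq_iff_im.mp (hH.apply 0 0)
  have hdet : hH.eigenvalues 0 * hH.eigenvalues 1
      = (X 0 0).re * (X 1 1).re - Complex.normSq (X 0 1) := by
    have := congrArg Complex.re hH.det_eq_prod_eigenvalues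
    simp only [det_fin_two, Fin.prod_univ_two, h10] at this
    simp [h00, Complex.normSq_apply] at this ⊢
    linarith
  have hs := trace_matrixRpow_re hH s
  rw [Fin.sum_univ_two] at hs
  rcases le_total (hH.eigenvalues 0) (hH.eigenvalues 1) with h | h
  · exact ⟨_, _, hX.eigenvalues_nonneg 0, h, htr, hdet, hs⟩
  · exact ⟨_, _, hX.eigenvalues_nonneg 1, h, by linarith, by linarith, by linarith⟩

lemma normSq_le_of_posSemidef {G : Matrix (Fin 2) (Fin 2) ℂ} (hG : G.PosSemidef) :
    Complex.normSq (G 0 1) ≤ (G 0 0).re * (G 1 1).re := by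
  obtain ⟨x, y, hx, hxy, -, h, -⟩ := exists_trace_matrixRpow_eq hG 1
  nlinarith [mul_nonneg hx (hx.trans hxy)]

lemma re_diag_nonneg {G : Matrix (Fin 2) (Fin 2) ℂ} (hG : G.PosSemidef) (i : Fin 2) :
    0 ≤ (G i i).re := (Complex.le_def.mp (hG.diag_nonneg (i := i))).1

lemma posSemidef_diagonal_zero_right {N : ℝ} (hN : 0 ≤ N) :
    (diagonal ![0, (N : ℂ)]).PosSemidef :=
  PosSemidef.diagonal fun i => by fin_cases i <;> simp [hN]

lemma trace_matrixRpow_add_le {G : Matrix (Fin 2) (Fin 2) ℂ} (hG : G.PosSemidef) {N s : ℝ}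
    (hN : 0 ≤ N) (hs : 0 ≤ s) :
    (matrixRpow (G + diagonal ![0, (N : ℂ)]) s).trace.re
      ≤ (G 0 0).re ^ s + ((G 0 0).re + (G 1 1).re + N) ^ s := by
  obtain ⟨x, y, hx, hxy, hsum, hprod, h⟩ :=
    exists_trace_matrixRpow_eq (hG.add (posSemidef_diagonal_zero_right hN)) s
  simp at hsum hprod
  have hxg : x ≤ (G 0 0).re := by
    by_contra! hlt
    nlinarith [Complex.normSq_nonneg (G 0 1),
      mul_pos (sub_pos.2 hlt) (sub_pos.2 (hlt.trans_le hxy))]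
  rw [h]
  exact add_le_add (Real.rpow_le_rpow hx hxg hs)
    (Real.rpow_le_rpow (hx.trans hxy) (by linarith) hs)

lemma le_trace_matrixRpow_add {G : Matrix (Fin 2) (Fin 2) ℂ} (hG : G.PosSemidef) {N s : ℝ}
    (hN : 0 < N) (hs : 0 ≤ s) :
    N ^ s + ((G 0 0).re * (N / ((G 0 0).re + (G 1 1).re + N))) ^ s
      ≤ (matrixRpow (G + diagonal ![0, (N : ℂ)]) s).trace.re := by
  obtain ⟨x, y, hx, hxy, hsum, hprod, h⟩ :=
    exists_trace_matrixRpow_eq (hG.add (posSemidef_diagonal_zero_right hN.le)) s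
  simp at hsum hprod
  have hg := re_diag_nonneg hG 0
  have hd := re_diag_nonneg hG 1
  have hGdet := normSq_le_of_posSemidef hG
  have hy : N ≤ y := by
    by_contra! hlt
    have h1 : y < (G 1 1).re + N := by linarith
    nlinarith [Complex.normSq_nonneg (G 0 1),
      mul_pos (sub_pos.2 h1) (sub_pos.2 (hxy.trans_lt h1))]
  have hpos : 0 < (G 0 0).re + (G 1 1).re + N := by linarith
  have hx' : (G 0 0).re * (N / ((G 0 0).re + (G 1 1).re + N)) ≤ x := by
    rw [← mul_div_assoc, div_le_iff₀ hpos]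
    nlinarith [mul_nonneg hx hx]
  rw [h, add_comm (x ^ s)]
  exact add_le_add (Real.rpow_le_rpow hN.le hy hs)
    (Real.rpow_le_rpow (mul_nonneg hg (div_nonneg hN.le hpos.le)) hx' hs)

open Filter Topology in
lemma tendsto_add_rpow_sub_rpow {q t : ℝ} (hq : 0 < q) (hq1 : q < 1) (ht : 0 ≤ t) :
    Tendsto (fun N : ℝ => (t + N) ^ q - N ^ q) atTop (𝓝 0) := by
  have hlim : Tendsto (fun N : ℝ => q * t * N ^ (-(1 - q))) atTop (𝓝 0) := by
    simpa using (tendsto_rpow_neg_atTop (sub_pos.2 hq1)).const_mul (q * t)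
  refine squeeze_zero' ?_ ?_ hlim
  · filter_upwards [eventually_ge_atTop 0] with N hN
    exact sub_nonneg.2 (Real.rpow_le_rpow hN (by linarith) hq.le)
  · filter_upwards [eventually_gt_atTop 0] with N hN
    have htN : 0 ≤ t / N := div_nonneg ht hN.le
    have h1 : (t + N) ^ q = N ^ q * (1 + t / N) ^ q := by
      rw [← Real.mul_rpow hN.le (by linarith)]
      congr 1
      field_simp
      ring
    have h2 : (1 + t / N) ^ q ≤ 1 + q * (t / N) :=
      rpow_one_add_le_one_add_mul_self (by linarith) hq.le hq1.le
    have h3 : N ^ (-(1 - q)) = N ^ q / N := by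
      rw [neg_sub, Real.rpow_sub hN, Real.rpow_one]
    have h4 := mul_le_mul_of_nonneg_left h2 (Real.rpow_nonneg hN.le q)
    rw [h1, h3]
    calc _ ≤ N ^ q * (1 + q * (t / N)) - N ^ q := by linarith
      _ = _ := by ring

open Filter Topology in
lemma exists_pos_rpow_lt {q a g t₁ t₂ t₃ : ℝ} (hq : 0 < q) (hq1 : q < 1) (hg : 0 ≤ g)
    (ha : g < a) (h₁ : 0 ≤ t₁) (h₂ : 0 ≤ t₂) :
    ∃ N : ℝ, 0 < N ∧ 1 / 2 * (g ^ q + (t₁ + N) ^ q) + 1 / 2 * (t₂ + N) ^ q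
      < N ^ q + (a * (N / (t₃ + N))) ^ q := by
  have hfrac : Tendsto (fun N : ℝ => N / (t₃ + N)) atTop (𝓝 1) := by
    have h : Tendsto (fun N : ℝ => 1 - t₃ / (t₃ + N)) atTop (𝓝 (1 - 0)) :=
      tendsto_const_nhds.sub
        (tendsto_const_nhds.div_atTop (tendsto_atTop_add_const_left _ _ tendsto_id))
    rw [sub_zero] at h
    refine h.congr' ?_
    filter_upwards [eventually_gt_atTop (-t₃)] with N hN
    have : t₃ + N ≠ 0 := by linarith
    field_simp
    ring
  have hR : Tendsto (fun N : ℝ => (a * (N / (t₃ + N))) ^ q) atTop (𝓝 (a ^ q)) := by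
    simpa using (hfrac.const_mul a).rpow_const (p := q) (Or.inr hq.le)
  have hL : Tendsto (fun N : ℝ => 1 / 2 * g ^ q + 1 / 2 * ((t₁ + N) ^ q - N ^ q)
      + 1 / 2 * ((t₂ + N) ^ q - N ^ q)) atTop (𝓝 (1 / 2 * g ^ q + 1 / 2 * 0 + 1 / 2 * 0)) :=
    (tendsto_const_nhds.add ((tendsto_add_rpow_sub_rpow hq hq1 h₁).const_mul _)).add
      ((tendsto_add_rpow_sub_rpow hq hq1 h₂).const_mul _)
  have hlt : 1 / 2 * g ^ q + 1 / 2 * 0 + 1 / 2 * 0 < a ^ q := by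
    have := Real.rpow_lt_rpow hg ha hq
    have := Real.rpow_nonneg hg q
    linarith
  obtain ⟨N, hN, hNpos⟩ := ((hL.eventually_lt hR hlt).and (eventually_gt_atTop 0)).exists
  exact ⟨N, hNpos, by linarith⟩

/-- A positive semidefinite matrix with eigenvector `(1, y)` and eigenvalue `L` has upper left
entry at least `L / (1 + y ^ 2)`. -/
lemma div_le_of_mulVec_eq {G : Matrix (Fin 2) (Fin 2) ℂ} (hG : G.PosSemidef) {L y : ℝ}
    (hL : 0 < L) (hy : 0 < y) (h : G *ᵥ ![1, (y : ℂ)] = (L : ℂ) • ![1, (y : ℂ)]) :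
    L / (1 + y ^ 2) ≤ (G 0 0).re := by
  have h10 : G 1 0 = star (G 0 1) := (hG.isHermitian.apply 1 0).symm
  have e0 := congrArg Complex.re (congrFun h 0)
  have e1 := congrArg Complex.re (congrFun h 1)
  simp [mulVec, dotProduct, Fin.sum_univ_two, h10] at e0 e1
  have hdet := normSq_le_of_posSemidef hG
  rw [Complex.normSq_apply] at hdet
  set a := (G 0 0).re
  set b := (G 0 1).re
  set d := (G 1 1).re
  have hb : b * b ≤ a * d := by nlinarith [mul_self_nonneg (G 0 1).im]
  have hmain : b * L ≤ a * y * L := by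
    calc b * L = b * b * y + a * b := by rw [← e0]; ring
      _ ≤ a * d * y + a * b := by nlinarith
      _ = a * y * L := by linear_combination a * e1
  have hba : b ≤ a * y := le_of_mul_le_mul_right hmain hL
  rw [div_le_iff₀ (by positivity)]
  nlinarith

/-- The midpoint of the all-ones matrix and `diag (0, y - 1 / y)` has eigenvector `(1, y)`. -/
lemma midpoint_mulVec {y : ℝ} (hy : 0 < y) :
    ((1 / 2 : ℝ) • ((of fun _ _ => 1 : Matrix (Fin 2) (Fin 2) ℂ)
      + diagonal ![0, ((y - 1 / y : ℝ) : ℂ)])) *ᵥ ![1, (y : ℂ)]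
      = (((1 + y) / 2 : ℝ) : ℂ) • ![1, (y : ℂ)] := by
  have : (y : ℂ) ≠ 0 := by exact_mod_cast hy.ne'
  ext i
  fin_cases i
  · simp [mulVec, dotProduct, Fin.sum_univ_two]
    ring
  · simp [mulVec, dotProduct, Fin.sum_univ_two]
    field_simp
    ring

lemma matrixRpow_diagonal_zero_right (c : ℝ) {p : ℝ} (hp : p ≠ 0) :
    matrixRpow (diagonal ![0, (c : ℂ)]) p = diagonal ![0, ((c ^ p : ℝ) : ℂ)] := by
  have h := matrixRpow_diagonal ![0, c] p
  convert h using 2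
  · congr 1
    ext i
    fin_cases i <;> simp
  · ext i
    fin_cases i <;> simp [Real.zero_rpow hp]

open Filter in
/-- **Failure of convexity of `Φ_p` for `p > 2`, even separately in one argument:**
there exist a dimension `d` and positive semidefinite `d × d` matrices `A₁, A₂, B` with
`Tr((((A₁+A₂)/2)^p + B^p)^{1/p}) > ½ Tr((A₁^p + B^p)^{1/p}) + ½ Tr((A₂^p + B^p)^{1/p})`. -/
theorem phi_p_not_convex {p : ℝ} (hp : 2 < p) :
    ∃ (d : ℕ) (A₁ A₂ B : Matrix (Fin d) (Fin d) ℂ),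
      A₁.PosSemidef ∧ A₂.PosSemidef ∧ B.PosSemidef ∧
      (1 / 2) * (matrixRpow (matrixRpow A₁ p + matrixRpow B p) (1 / p)).trace.re
        + (1 / 2) * (matrixRpow (matrixRpow A₂ p + matrixRpow B p) (1 / p)).trace.re
      < (matrixRpow (matrixRpow ((1 / 2 : ℝ) • (A₁ + A₂)) p + matrixRpow B p)
          (1 / p)).trace.re := by
  have hp0 : p ≠ 0 := by linarith
  have hq : 0 < 1 / p := by positivity
  have hq1 : 1 / p < 1 := by rw [div_lt_one (by linarith)]; linarith
  set J : Matrix (Fin 2) (Fin 2) ℂ := of fun _ _ => 1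
  have hJ : J.PosSemidef := by
    have : J = vecMulVec 1 (star 1) := by ext; simp [J, vecMulVec]
    rw [this]
    exact posSemidef_vecMulVec_self_star _
  have hG₁ := matrixRpow_posSemidef hJ p
  set g := (matrixRpow J p 0 0).re
  obtain ⟨l, hl, hl1⟩ := (((tendsto_rpow_atTop (sub_pos.2 hp)).eventually_gt_atTop (4 * g)).and
    (eventually_ge_atTop 1)).exists
  set y := 2 * l - 1 with hy_def
  have hy1 : 1 ≤ y := by linarith
  have hc : 0 ≤ y - 1 / y := by
    have : 1 / y ≤ 1 := by rw [div_le_one (by linarith)]; exact hy1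
    linarith
  have hA₂ := posSemidef_diagonal_zero_right hc
  have hG₂ := matrixRpow_posSemidef hA₂ p
  have hC : ((1 / 2 : ℝ) • (J + diagonal ![0, ((y - 1 / y : ℝ) : ℂ)])).PosSemidef :=
    (hJ.add hA₂).smul (by norm_num)
  have hG₃ := matrixRpow_posSemidef hC p
  have hvec := matrixRpow_mulVec hC.isHermitian p (midpoint_mulVec (by linarith))
  have ha := div_le_of_mulVec_eq hG₃ (Real.rpow_pos_of_pos (by linarith) p) (by linarith) hvec
  have hga : g < (matrixRpow ((1 / 2 : ℝ) • (J + diagonal ![0, ((y - 1 / y : ℝ) : ℂ)])) p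
      0 0).re := by
    refine lt_of_lt_of_le ?_ ha
    have hly : (1 + y) / 2 = l := by rw [hy_def]; ring
    have hg : 0 ≤ g := re_diag_nonneg hG₁ 0
    rw [Real.rpow_sub (by linarith), lt_div_iff₀ (by positivity), Real.rpow_two] at hl
    rw [hly, lt_div_iff₀ (by positivity)]
    refine lt_of_le_of_lt ?_ hl
    rw [hy_def]
    nlinarith
  obtain ⟨N, hN, hlt⟩ := exists_pos_rpow_lt hq hq1 (re_diag_nonneg hG₁ 0) hga
    (add_nonneg (re_diag_nonneg hG₁ 0) (re_diag_nonneg hG₁ 1))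
    (add_nonneg (re_diag_nonneg hG₂ 0) (re_diag_nonneg hG₂ 1))
    (t₃ := (matrixRpow ((1 / 2 : ℝ) • (J + diagonal ![0, ((y - 1 / y : ℝ) : ℂ)])) p 0 0).re
      + (matrixRpow ((1 / 2 : ℝ) • (J + diagonal ![0, ((y - 1 / y : ℝ) : ℂ)])) p 1 1).re)
  refine ⟨2, J, diagonal ![0, ((y - 1 / y : ℝ) : ℂ)], diagonal ![0, ((N ^ (1 / p) : ℝ) : ℂ)],
    hJ, hA₂, posSemidef_diagonal_zero_right (Real.rpow_nonneg hN.le _), ?_⟩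
  have hB : matrixRpow (diagonal ![0, ((N ^ (1 / p) : ℝ) : ℂ)]) p = diagonal ![0, (N : ℂ)] := by
    rw [matrixRpow_diagonal_zero_right _ hp0, ← Real.rpow_mul hN.le, one_div_mul_cancel hp0,
      Real.rpow_one]
  rw [hB]
  have h₁ := trace_matrixRpow_add_le hG₁ hN.le hq.le
  have h₂ := trace_matrixRpow_add_le hG₂ hN.le hq.le
  have h₃ := le_trace_matrixRpow_add hG₃ hN hq.le
  have h00 : (matrixRpow (diagonal ![0, ((y - 1 / y : ℝ) : ℂ)]) p 0 0).re ^ (1 / p) = 0 := by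
    rw [matrixRpow_diagonal_zero_right _ hp0]
    simp [hp0]
  rw [h00] at h₂
  linarith
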